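/- Let Γ be an SNF-with-equality sentence over L with m ≥ 1 existentially quantified conjuncts, and set δ = max(m(m+1), 2m+1). A configuration n is satisfiable with respect to Γ if and only if there exists a configuration n′ with n′(τ) ≤ δ for every 1-type τ such that n′ is satisfiable with respect to Γ and for every 1-type τ: n(τ) ≥ n′(τ) whenever n′(τ) > 1, and n(τ) = n′(τ) whenever n′(τ) ≤ 1. -/

import Mathlib

/-- An `L`-structure (for a language `L` with unary symbols `U` and binary
symbols `B`) on domain `D`. -/
structure Struc (U B : Type) (D : Type) where
  unary : U → D → Prop
  binary : B → D → D → Prop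

/-- Quantifier-free formulas over relational atoms and equality atoms in the two
variables `x` (encoded as `false`) and `y` (encoded as `true`), built using
`¬`, `∧`, `∨`. -/
inductive QFE (U B : Type) where
  | uatom : U → Bool → QFE U B
  | batom : B → Bool → Bool → QFE U B
  | eq : Bool → Bool → QFE U B
  | not : QFE U B → QFE U B
  | and : QFE U B → QFE U B → QFE U B
  | or : QFE U B → QFE U B → QFE U B

/-- Evaluation of a quantifier-free formula in a structure with `x ↦ a`, `y ↦ b`. -/
def QFE.Eval {U B D : Type} (S : Struc U B D) (a b : D) : QFE U B → Prop
  | .uatom P v => S.unary P (if v then b else a)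
  | .batom R v w => S.binary R (if v then b else a) (if w then b else a)
  | .eq v w => (if v then b else a) = (if w then b else a)
  | .not f => ¬ f.Eval S a b
  | .and f g => f.Eval S a b ∧ g.Eval S a b
  | .or f g => f.Eval S a b ∨ g.Eval S a b

/-- An SNF-with-equality sentence `(∀x∀y φ(x,y)) ∧ ⋀_{k=1}^m (∀x∃y β_k(x,y))`,
where `φ` may contain equality atoms. -/
structure SNFE (U B : Type) where
  m : ℕ
  phi : QFE U B
  beta : Fin m → B

/-- Satisfaction of an SNF-with-equality sentence in a structure. -/
def SNFE.Sat {U B D : Type} (Γ : SNFE U B) (S : Struc U B D) : Prop :=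
  (∀ a b, Γ.phi.Eval S a b) ∧ ∀ k a, ∃ b, S.binary (Γ.beta k) a b

/-- A 1-type: a truth-value assignment to each atomic formula `P(x)`, `R(x,x)`. -/
structure OneType (U B : Type) where
  unary : U → Prop
  binary : B → Prop

/-- An element `e` realizes a 1-type `τ` in a structure `S`. -/
def Realizes1 {U B D : Type} (S : Struc U B D) (e : D) (τ : OneType U B) : Prop :=
  (∀ P, S.unary P e ↔ τ.unary P) ∧ (∀ R, S.binary R e e ↔ τ.binary R)

/-- The configuration of a structure: the number of elements realizing each 1-type. -/
noncomputable def config {U B D : Type} (S : Struc U B D) : OneType U B → ℕ :=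
  fun τ => Nat.card {e : D // Realizes1 S e τ}

/-- A configuration `n` is satisfiable w.r.t. `Γ`: some finite model of `Γ` has
configuration `n`. -/
def SatConfig {U B : Type} (Γ : SNFE U B) (n : OneType U B → ℕ) : Prop :=
  ∃ (D : Type) (_ : Fintype D) (M : Struc U B D), Γ.Sat M ∧ config M = n

/-- On a set with at least `2m + 1` elements one can orient edges so that every point has `m`
distinct out-neighbours and no edge is used in both directions. -/
theorem exists_outNeighbours {α : Type} [Finite α] {m : ℕ} (h : 2 * m + 1 ≤ Nat.card α) :
    ∃ σ : α → Fin m → α, (∀ x, Function.Injective (σ x)) ∧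
      ∀ x k k', σ (σ x k) k' ≠ x := by
  classical
  have : Fintype α := Fintype.ofFinite α
  obtain ⟨c, hc⟩ : ∃ c, c = Nat.card α := ⟨_, rfl⟩
  have : NeZero c := ⟨by omega⟩
  have e : α ≃ ZMod c := Fintype.equivOfCardEq (by
    rw [ZMod.card, hc, Nat.card_eq_fintype_card])
  refine ⟨fun x k => e.symm (e x + ((k.1 + 1 : ℕ) : ZMod c)), ?_, ?_⟩
  · intro x k k' hk
    have h1 := add_left_cancel (e.symm.injective hk)
    rw [ZMod.natCast_eq_natCast_iff', Nat.mod_eq_of_lt (by omega),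
      Nat.mod_eq_of_lt (by omega)] at h1
    exact Fin.ext (by omega)
  · intro x k k' hk
    have h1 : e x + (((k.1 + 1) + (k'.1 + 1) : ℕ) : ZMod c) = e x + 0 := by
      have := congrArg e hk
      simp only [Equiv.apply_symm_apply] at this
      rw [add_zero, Nat.cast_add, ← add_assoc]
      exact this
    have h2 := add_left_cancel h1
    rw [ZMod.natCast_eq_zero_iff] at h2
    have := Nat.le_of_dvd (by omega) h2
    omega

section

variable {U B : Type}

/-- The 1-type realized by an element. -/
def Struc.typeOf {D : Type} (M : Struc U B D) (e : D) : OneType U B :=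
  ⟨fun P => M.unary P e, fun R => M.binary R e e⟩

theorem realizes1_iff {D : Type} (M : Struc U B D) (e : D) (τ : OneType U B) :
    Realizes1 M e τ ↔ M.typeOf e = τ := by
  obtain ⟨u, b⟩ := τ
  simp [Realizes1, Struc.typeOf, funext_iff]

open Classical in
theorem config_eq_card {D : Type} [Fintype D] (M : Struc U B D) (τ : OneType U B) :
    config M τ = (Finset.univ.filter fun e => M.typeOf e = τ).card := by
  simp only [config, realizes1_iff]
  rw [Nat.card_eq_fintype_card, Fintype.card_subtype]

/-- The structure on `E` in which the pair `(x, y)` looks like `(f x y, f y x)` in `M`. -/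
def Struc.pullback {D E : Type} (M : Struc U B D) (f : E → E → D) : Struc U B E where
  unary P x := M.unary P (f x x)
  binary R x y := M.binary R (f x y) (f y x)

theorem Struc.typeOf_pullback {D E : Type} (M : Struc U B D) (f : E → E → D) (x : E) :
    (M.pullback f).typeOf x = M.typeOf (f x x) := rfl

theorem QFE.eval_pullback {D E : Type} (M : Struc U B D) (f : E → E → D)
    (hf : ∀ x y, M.typeOf (f x y) = M.typeOf (f x x)) (hne : ∀ x y, f x y = f y x → x = y)
    (x y : E) (φ : QFE U B) :
    φ.Eval (M.pullback f) x y ↔ φ.Eval M (f x y) (f y x) := by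
  have hu : ∀ P x y, M.unary P (f x x) ↔ M.unary P (f x y) := fun P x y =>
    iff_of_eq (congrFun (congrArg OneType.unary (hf x y)) P).symm
  have hb : ∀ R x y, M.binary R (f x x) (f x x) ↔ M.binary R (f x y) (f x y) := fun R x y =>
    iff_of_eq (congrFun (congrArg OneType.binary (hf x y)) R).symm
  have he : x = y ↔ f x y = f y x := ⟨fun h => by rw [h], hne x y⟩
  have he' : y = x ↔ f y x = f x y := ⟨fun h => by rw [h], hne y x⟩
  induction φ with
  | uatom P v => cases v <;> simp [QFE.Eval, Struc.pullback, hu P x y, hu P y x]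
  | batom R v w =>
    cases v <;> cases w <;> simp [QFE.Eval, Struc.pullback, hb R x y, hb R y x]
  | eq v w => cases v <;> cases w <;> simp [QFE.Eval, he, he']
  | not f ih => simp [QFE.Eval, ih]
  | and f g ih1 ih2 => simp [QFE.Eval, ih1, ih2]
  | or f g ih1 ih2 => simp [QFE.Eval, ih1, ih2]

theorem SNFE.sat_pullback {D E : Type} {Γ : SNFE U B} {M : Struc U B D} (hM : Γ.Sat M)
    (f : E → E → D) (hf : ∀ x y, M.typeOf (f x y) = M.typeOf (f x x))
    (hne : ∀ x y, f x y = f y x → x = y)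
    (hw : ∀ k x, ∃ y, M.binary (Γ.beta k) (f x y) (f y x)) : Γ.Sat (M.pullback f) :=
  ⟨fun x y => (QFE.eval_pullback M f hf hne x y _).2 (hM.1 _ _), hw⟩

open Classical in
/-- A 1-type realized at least twice can be realized once more. -/
theorem SatConfig.add_one {Γ : SNFE U B} {n : OneType U B → ℕ} (h : SatConfig Γ n)
    {τ : OneType U B} (hτ : 1 < n τ) : SatConfig Γ (Function.update n τ (n τ + 1)) := by
  obtain ⟨D, _, M, hM, rfl⟩ := h
  rw [config_eq_card, Finset.one_lt_card] at hτ
  obtain ⟨a, ha, b, hb, hab⟩ := hτ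
  simp only [Finset.mem_filter, Finset.mem_univ, true_and] at ha hb
  let f : Option D → Option D → D := fun x y =>
    match x, y with
    | none, _ => a
    | some x, none => if x = a then b else x
    | some x, some _ => x
  refine ⟨Option D, inferInstance, M.pullback f, SNFE.sat_pullback hM f ?_ ?_ ?_, ?_⟩
  · rintro (_ | x) (_ | y) <;> simp only [f]
    split_ifs with hx
    · rw [hb, hx, ha]
    · rfl
  · rintro (_ | x) (_ | y) <;> simp only [f]
    · simp
    · split_ifs with hx
      · exact fun h => absurd h hab
      · exact fun h => absurd h.symm hx
    · split_ifs with hx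
      · exact fun h => absurd h.symm hab
      · exact fun h => absurd h hx
    · exact fun h => congrArg some h
  · rintro k (_ | x)
    · obtain ⟨d, hd⟩ := hM.2 k a
      by_cases hda : d = a
      · exact ⟨none, by simpa [f, hda] using hd⟩
      · exact ⟨some d, by simpa [f, hda] using hd⟩
    · obtain ⟨d, hd⟩ := hM.2 k x
      exact ⟨some d, hd⟩
  · funext σ
    have hdiag : ∀ e, (M.pullback f).typeOf e = M.typeOf (e.getD a) := by
      rintro (_ | x) <;> rfl
    rw [config_eq_card]
    have hs : (Finset.univ.filter fun e => (M.pullback f).typeOf e = σ) =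
        (if σ = τ then {none} else ∅) ∪
          (Finset.univ.filter fun e => M.typeOf e = σ).map Function.Embedding.some := by
      ext (_ | x)
      · by_cases hσ : σ = τ
        · simp [hdiag, ha, hσ]
        · simp [hdiag, ha, hσ, Ne.symm hσ]
      · by_cases hσ : σ = τ <;> simp [hdiag, hσ]
    rw [hs, Finset.card_union_of_disjoint, Finset.card_map]
    · by_cases hσ : σ = τ
      · subst hσ
        simp [config_eq_card, add_comm]
      · simp [config_eq_card, hσ]
    · by_cases hσ : σ = τ <;> simp [hσ]

/-- Restrict `M` to `E` and reroute some witnesses: if `act x k` holds then the pair `(x, σ x k)`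
is made to look like `(x, w k x)`. -/
theorem SNFE.exists_sat_of_reroute {D : Type} {Γ : SNFE U B} {M : Struc U B D} (hM : Γ.Sat M)
    {p : D → Prop} (w : Fin Γ.m → D → D) (hw : ∀ k x, M.binary (Γ.beta k) x (w k x))
    (act : Subtype p → Fin Γ.m → Prop) (σ : Subtype p → Fin Γ.m → Subtype p)
    (htype : ∀ x k, act x k → M.typeOf (w k x) = M.typeOf (σ x k : D))
    (hself : ∀ x k, act x k → w k x ≠ x)
    (hinj : ∀ x k k', act x k → act x k' → σ x k = σ x k' → k = k')
    (hcycle : ∀ x k k', act x k → act (σ x k) k' → σ (σ x k) k' ≠ x)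
    (hkeep : ∀ x k, ¬ act x k → ∃ y : Subtype p, (y : D) = w k x ∧
      (∀ k', act x k' → σ x k' ≠ y) ∧ (∀ k', act y k' → σ y k' ≠ x)) :
    ∃ M' : Struc U B (Subtype p), Γ.Sat M' ∧ ∀ x, M'.typeOf x = M.typeOf x := by
  classical
  let f : Subtype p → Subtype p → D := fun x y =>
    if h : ∃ k, act y k ∧ σ y k = x then w h.choose y else x
  have hact : ∀ x k, act x k → f (σ x k) x = w k x := by
    intro x k hk
    have h : ∃ k', act x k' ∧ σ x k' = σ x k := ⟨k, hk, rfl⟩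
    have hk' : h.choose = k := hinj _ _ _ h.choose_spec.1 hk h.choose_spec.2
    simp only [f]
    rw [dif_pos h, hk']
  have hdef : ∀ x y, (∀ k, act y k → σ y k ≠ x) → f x y = x := by
    intro x y h
    simp only [f]
    rw [dif_neg]
    rintro ⟨k, hk, hx⟩
    exact h k hk hx
  have hback : ∀ x k, act x k → f x (σ x k) = x :=
    fun x k hk => hdef _ _ fun k' hk' => hcycle x k k' hk hk'
  have hloop : ∀ x k, act x k → σ x k ≠ x := by
    intro x k hk h
    have := hcycle x k k hk (by rwa [h])
    rw [h] at this
    exact this h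
  have hdiag : ∀ x, f x x = x := fun x => hdef x x (hloop x)
  refine ⟨M.pullback f, SNFE.sat_pullback hM f ?_ ?_ ?_, fun x => ?_⟩
  · intro x y
    rw [hdiag]
    by_cases h : ∃ k, act y k ∧ σ y k = x
    · obtain ⟨k, hk, rfl⟩ := h
      rw [hact _ _ hk, htype _ _ hk]
    · push Not at h
      rw [hdef _ _ h]
  · intro x y hxy
    by_cases h : ∃ k, act y k ∧ σ y k = x
    · obtain ⟨k, hk, rfl⟩ := h
      rw [hact _ _ hk, hback _ _ hk] at hxy
      exact absurd hxy (hself _ _ hk)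
    · by_cases h' : ∃ k, act x k ∧ σ x k = y
      · obtain ⟨k, hk, rfl⟩ := h'
        rw [hact _ _ hk, hback _ _ hk] at hxy
        exact absurd hxy.symm (hself _ _ hk)
      · push Not at h h'
        rw [hdef _ _ h, hdef _ _ h'] at hxy
        exact Subtype.ext hxy
  · intro k x
    by_cases hk : act x k
    · exact ⟨σ x k, by rw [hback _ _ hk, hact _ _ hk]; exact hw k x⟩
    · obtain ⟨y, hy, h1, h2⟩ := hkeep x k hk
      exact ⟨y, by rw [hdef _ _ h2, hdef _ _ h1, hy]; exact hw k x⟩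
  · rw [Struc.typeOf_pullback, hdiag]

open Classical in
/-- Among the points of a large set `A`, some point is not a chosen value `w k b` of any point `b`
that all but at most `m` points of `A` select. -/
theorem exists_mem_not_selected {D : Type} [Fintype D] {m : ℕ} (A : Finset D)
    (hA : m * (m + 1) < A.card) (w : Fin m → D → D) :
    ∃ a ∈ A, ∀ b, (A.filter fun d => ∀ k, w k d ≠ b).card ≤ m → ∀ k, w k b ≠ a := by
  set P : Finset D := Finset.univ.filter fun b => (A.filter fun d => ∀ k, w k d ≠ b).card ≤ m
    with hP
  have hPm : P.card ≤ m := by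
    by_contra! hlt
    obtain ⟨T, hT, hTc⟩ := Finset.exists_subset_card_eq (Nat.succ_le_of_lt hlt)
    have hU : (T.biUnion fun b => A.filter fun d => ∀ k, w k d ≠ b).card < A.card := by
      refine lt_of_le_of_lt (Finset.card_biUnion_le_card_mul _ _ m fun b hb => ?_) ?_
      · exact (Finset.mem_filter.1 (hT hb)).2
      · rw [hTc, mul_comm]
        exact hA
    obtain ⟨d, hdA, hd⟩ := Finset.exists_mem_notMem_of_card_lt_card hU
    have hsub : T ⊆ Finset.univ.image fun k => w k d := by
      intro b hb
      by_contra hb'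
      refine hd (Finset.mem_biUnion.2 ⟨b, hb, Finset.mem_filter.2 ⟨hdA, fun k hk => hb' ?_⟩⟩)
      exact Finset.mem_image.2 ⟨k, Finset.mem_univ _, hk⟩
    have h1 := (Finset.card_le_card hsub).trans Finset.card_image_le
    rw [hTc, Finset.card_univ, Fintype.card_fin] at h1
    omega
  have hI : ((P ×ˢ Finset.univ).image fun q : D × Fin m => w q.2 q.1).card < A.card := by
    refine lt_of_le_of_lt Finset.card_image_le ?_
    rw [Finset.card_product, Finset.card_univ, Fintype.card_fin]
    nlinarith
  obtain ⟨a, haA, ha⟩ := Finset.exists_mem_notMem_of_card_lt_card hI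
  refine ⟨a, haA, fun b hb k hk => ha ?_⟩
  exact Finset.mem_image.2 ⟨(b, k), by simp [hP, hb], hk⟩

open Classical in
/-- A model in which the 1-type `τ` is realized more than `max (m(m+1)) (2m+1)` times can be
modified to lose one realization of `τ`. -/
theorem SNFE.exists_sat_remove {D : Type} [Fintype D] {Γ : SNFE U B} {M : Struc U B D}
    (hM : Γ.Sat M) (τ : OneType U B)
    (hτ : max (Γ.m * (Γ.m + 1)) (2 * Γ.m + 1) < config M τ) :
    ∃ a, M.typeOf a = τ ∧
      ∃ M' : Struc U B {d // d ≠ a}, Γ.Sat M' ∧ ∀ x, M'.typeOf x = M.typeOf x := by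
  choose w hw using hM.2
  rw [config_eq_card] at hτ
  set A : Finset D := Finset.univ.filter fun e => M.typeOf e = τ with hAdef
  have hmem : ∀ d, d ∈ A ↔ M.typeOf d = τ := by simp [hAdef]
  obtain ⟨a, haA, ha⟩ := exists_mem_not_selected A (lt_of_le_of_lt (le_max_left _ _) hτ) w
  refine ⟨a, (hmem a).1 haA, ?_⟩
  set popular : D → Prop := fun b => (A.filter fun d => ∀ k, w k d ≠ b).card ≤ Γ.m with hpop
  have hcardA : 2 * Γ.m + 1 ≤ Nat.card {d // d ∈ A.erase a} := by
    rw [Nat.card_eq_fintype_card, Fintype.card_coe, Finset.card_erase_of_mem haA]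
    have := lt_of_le_of_lt (le_max_right _ _) hτ
    omega
  obtain ⟨σA, hσinj, hσcyc⟩ := exists_outNeighbours hcardA
  have hfree : ∀ b, ¬ popular b → ∃ s : Fin Γ.m → {d // d ≠ a}, Function.Injective s ∧
      ∀ k, M.typeOf (s k : D) = τ ∧ ∀ k', w k' (s k) ≠ b := by
    intro b hb
    have hc : Fintype.card (Fin Γ.m) ≤
        Fintype.card {d // d ∈ (A.filter fun d => ∀ k, w k d ≠ b).erase a} := by
      rw [Fintype.card_coe, Fintype.card_fin]
      have := Finset.pred_card_le_card_erase (s := A.filter fun d => ∀ k, w k d ≠ b) (a := a)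
      simp only [hpop, not_le] at hb
      omega
    obtain ⟨s⟩ := Function.Embedding.nonempty_of_card_le hc
    refine ⟨fun k => ⟨s k, (Finset.mem_erase.1 (s k).2).1⟩, fun k k' h => ?_, fun k => ?_⟩
    · exact s.injective (Subtype.ext (Subtype.mk.inj h))
    · have h := Finset.mem_filter.1 (Finset.mem_erase.1 (s k).2).2
      exact ⟨(hmem _).1 h.1, h.2⟩
  choose s hsinj hs using hfree
  let σ : {d // d ≠ a} → Fin Γ.m → {d // d ≠ a} := fun x k =>
    if hx : M.typeOf x = τ then
      ⟨σA ⟨x, Finset.mem_erase.2 ⟨x.2, (hmem _).2 hx⟩⟩ k, (Finset.mem_erase.1 (Subtype.prop _)).1⟩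
    else if hp : popular x then x else s x hp k
  have hσ1 : ∀ (x : {d // d ≠ a}) (hx : M.typeOf x = τ) k,
      (σ x k : D) = σA ⟨x, Finset.mem_erase.2 ⟨x.2, (hmem _).2 hx⟩⟩ k := by
    intro x hx k
    simp only [σ]
    rw [dif_pos hx]
  have hσ2 : ∀ x : {d // d ≠ a}, M.typeOf x ≠ τ → ∀ hp : ¬ popular x, σ x = s x hp := by
    intro x hx hp
    funext k
    simp only [σ]
    rw [dif_neg hx, dif_neg hp]
  have hσtype : ∀ (x : {d // d ≠ a}) k, (M.typeOf x = τ ∨ ¬ popular x) → M.typeOf (σ x k : D) = τ := by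
    intro x k h
    by_cases hx : M.typeOf x = τ
    · rw [hσ1 x hx k]
      exact (hmem _).1 (Finset.mem_erase.1 (Subtype.prop _)).2
    · have hp := h.resolve_left hx
      rw [hσ2 x hx hp]
      exact (hs _ _ k).1
  have hcycle : ∀ (x : {d // d ≠ a}) k k', (M.typeOf x = τ ∨ ¬ popular x) → σ (σ x k) k' ≠ x := by
    intro x k k' hx h
    have hy := hσtype x k hx
    have hx' : M.typeOf x = τ := by rw [← h]; exact hσtype _ _ (Or.inl hy)
    apply hσcyc ⟨x, Finset.mem_erase.2 ⟨x.2, (hmem _).2 hx'⟩⟩ k k'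
    apply Subtype.ext
    have h1 := hσ1 (σ x k) hy k'
    rw [h] at h1
    refine Eq.trans ?_ h1.symm
    congr 2
    exact Subtype.ext (hσ1 x hx' k).symm
  refine SNFE.exists_sat_of_reroute hM w hw
    (fun x k => M.typeOf (w k x) = τ ∧ w k x ≠ x ∧ (M.typeOf x = τ ∨ ¬ popular x)) σ
    ?_ ?_ ?_ ?_ ?_
  · rintro x k ⟨h1, -, h3⟩
    rw [h1, hσtype x k h3]
  · exact fun x k h => h.2.1
  · rintro x k k' ⟨-, -, h⟩ - he
    by_cases hx : M.typeOf x = τ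
    · apply hσinj ⟨x, Finset.mem_erase.2 ⟨x.2, (hmem _).2 hx⟩⟩
      apply Subtype.ext
      rw [← hσ1 x hx k, ← hσ1 x hx k', he]
    · rw [hσ2 x hx (h.resolve_left hx)] at he
      exact hsinj _ _ he
  · exact fun x k k' h _ => hcycle x k k' h.2.2
  · intro x k hk
    by_cases h1 : M.typeOf (w k x) = τ
    · by_cases h2 : w k x = x
      · have hloop : ∀ k', (M.typeOf x = τ ∨ ¬ popular x) → σ x k' ≠ x := by
          intro k' hx h
          have := hcycle x k' k' hx
          rw [h] at this
          exact this h
        exact ⟨x, h2.symm, fun k' h => hloop k' h.2.2, fun k' h => hloop k' h.2.2⟩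
      · have h3 : ¬ (M.typeOf x = τ ∨ ¬ popular x) := fun h => hk ⟨h1, h2, h⟩
        push Not at h3
        refine ⟨⟨w k x, ha x h3.2 k⟩, rfl, fun k' h => ?_, fun k' h e => ?_⟩
        · exact absurd h.2.2 (by simpa using h3)
        · exact h3.1 (by rw [← e]; exact hσtype _ _ h.2.2)
    · refine ⟨⟨w k x, fun h => h1 (by rw [h]; exact (hmem a).1 haA)⟩, rfl,
        fun k' h e => ?_, fun k' h e => ?_⟩
      · apply h1
        have := hσtype x k' h.2.2
        rwa [e] at this
      · have hp := h.2.2.resolve_left h1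
        rw [hσ2 _ h1 hp] at e
        have := (hs _ hp k').2 k
        rw [e] at this
        exact this rfl

open Classical in
theorem config_remove {D : Type} [Fintype D] {M : Struc U B D} {a : D} {τ : OneType U B}
    (ha : M.typeOf a = τ) {M' : Struc U B {d // d ≠ a}}
    (hM' : ∀ x, M'.typeOf x = M.typeOf x) :
    config M' = Function.update (config M) τ (config M τ - 1) := by
  funext σ
  have hmap : (Finset.univ.filter fun e => M'.typeOf e = σ).map (Function.Embedding.subtype _) =
      (Finset.univ.filter fun e => M.typeOf e = σ).erase a := by
    ext x
    simp only [Finset.mem_map, Finset.mem_filter, Finset.mem_univ, true_and,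
      Function.Embedding.subtype_apply, Finset.mem_erase, hM']
    exact ⟨fun ⟨y, hy, e⟩ => e ▸ ⟨y.2, hy⟩, fun ⟨h1, h2⟩ => ⟨⟨x, h1⟩, h2, rfl⟩⟩
  rw [config_eq_card, ← Finset.card_map (Function.Embedding.subtype _), hmap]
  by_cases hσ : σ = τ
  · subst hσ
    rw [Function.update_self, config_eq_card, Finset.card_erase_of_mem (by simp [ha])]
  · rw [Function.update_of_ne hσ, config_eq_card, Finset.erase_eq_of_notMem]
    simpa [ha] using Ne.symm hσ

/-- `n` arises from `n'` by increasing the values that exceed one. -/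
def IsInflation (n' n : OneType U B → ℕ) : Prop :=
  ∀ τ, (1 < n' τ → n' τ ≤ n τ) ∧ (n' τ ≤ 1 → n τ = n' τ)

theorem SNFE.exists_bounded_config (Γ : SNFE U B) (hm : 1 ≤ Γ.m) (N : ℕ) :
    ∀ (D : Type) (_ : Fintype D) (M : Struc U B D), Fintype.card D = N → Γ.Sat M →
      ∃ n' : OneType U B → ℕ, (∀ τ, n' τ ≤ max (Γ.m * (Γ.m + 1)) (2 * Γ.m + 1)) ∧
        SatConfig Γ n' ∧ IsInflation n' (config M) := by
  classical
  induction N with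
  | zero =>
    intro D _ M hD hM
    refine ⟨config M, fun τ => ?_, ⟨D, inferInstance, M, hM, rfl⟩,
      fun τ => ⟨fun _ => le_rfl, fun _ => rfl⟩⟩
    rw [config_eq_card]
    have := Finset.card_filter_le Finset.univ fun e => M.typeOf e = τ
    rw [Finset.card_univ, hD] at this
    omega
  | succ N ih =>
    intro D _ M hD hM
    by_cases h : ∀ τ, config M τ ≤ max (Γ.m * (Γ.m + 1)) (2 * Γ.m + 1)
    · exact ⟨config M, h, ⟨D, inferInstance, M, hM, rfl⟩,
        fun τ => ⟨fun _ => le_rfl, fun _ => rfl⟩⟩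
    · push Not at h
      obtain ⟨τ, hτ⟩ := h
      obtain ⟨a, ha, M', hM', htype⟩ := SNFE.exists_sat_remove hM τ hτ
      have hcard : Fintype.card {d // d ≠ a} = N := by
        rw [Fintype.card_subtype_compl, Fintype.card_subtype_eq, hD, Nat.add_sub_cancel]
      obtain ⟨n', hb, hsat, hinf⟩ := ih _ inferInstance M' hcard hM'
      refine ⟨n', hb, hsat, fun σ => ?_⟩
      have h1 := hinf σ
      rw [config_remove ha htype] at h1
      by_cases hσ : σ = τ
      · subst hσ
        rw [Function.update_self] at h1
        have := lt_of_le_of_lt (le_max_right _ _) hτ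
        exact ⟨fun h => by have := h1.1 h; omega, fun h => by have := h1.2 h; omega⟩
      · rwa [Function.update_of_ne hσ] at h1

theorem OneType.finite [Finite U] [Finite B] : Finite (OneType U B) :=
  Finite.of_injective (fun τ : OneType U B => (τ.unary, τ.binary)) (by
    rintro ⟨u, b⟩ ⟨u', b'⟩ h
    simpa using h)

theorem SatConfig.of_isInflation [Finite U] [Finite B] {Γ : SNFE U B} {n' n : OneType U B → ℕ}
    (h : SatConfig Γ n') (hn : IsInflation n' n) : SatConfig Γ n := by
  classical
  have : Finite (OneType U B) := OneType.finite
  have : Fintype (OneType U B) := Fintype.ofFinite _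
  obtain ⟨s, hs⟩ : ∃ s, s = ∑ τ, (n τ - n' τ) := ⟨_, rfl⟩
  induction s generalizing n' with
  | zero =>
    have : n = n' := by
      funext τ
      have h0 := Finset.sum_eq_zero_iff.1 hs.symm τ (Finset.mem_univ _)
      have := hn τ
      omega
    rwa [this]
  | succ s ih =>
    have hs0 : ∑ τ, (n τ - n' τ) ≠ 0 := by omega
    obtain ⟨τ, -, hτ⟩ := Finset.exists_ne_zero_of_sum_ne_zero hs0
    have h1 : 1 < n' τ := by
      have := hn τ
      omega
    refine ih (h.add_one h1) (fun σ => ?_) ?_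
    · by_cases hσ : σ = τ
      · subst hσ
        rw [Function.update_self]
        have := (hn σ).1 h1
        omega
      · rw [Function.update_of_ne hσ]
        exact hn σ
    · rw [← Finset.add_sum_erase _ _ (Finset.mem_univ τ)] at hs ⊢
      have : ∑ σ ∈ Finset.univ.erase τ, (n σ - Function.update n' τ (n' τ + 1) σ) =
          ∑ σ ∈ Finset.univ.erase τ, (n σ - n' σ) :=
        Finset.sum_congr rfl fun σ hσ => by
          rw [Function.update_of_ne (Finset.ne_of_mem_erase hσ)]
      rw [this, Function.update_self]
      omega

end

/-- For an SNF-with-equality sentence with `m ≥ 1` and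
`δ = max (m(m+1)) (2m+1)`: a configuration `n` is satisfiable w.r.t. `Γ` iff
there is a satisfiable configuration `n'` bounded by `δ` such that for every
1-type `τ`, `n τ ≥ n' τ` whenever `n' τ > 1`, and `n τ = n' τ` whenever
`n' τ ≤ 1`. -/
theorem statement11 {U B : Type} [Fintype U] [Fintype B] (Γ : SNFE U B)
    (hm : 1 ≤ Γ.m) (n : OneType U B → ℕ) :
    SatConfig Γ n ↔
      ∃ n' : OneType U B → ℕ,
        (∀ τ, n' τ ≤ max (Γ.m * (Γ.m + 1)) (2 * Γ.m + 1)) ∧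
        SatConfig Γ n' ∧
        ∀ τ, (1 < n' τ → n' τ ≤ n τ) ∧ (n' τ ≤ 1 → n τ = n' τ) := by
  constructor
  · rintro ⟨D, _, M, hM, rfl⟩
    exact Γ.exists_bounded_config hm _ D inferInstance M rfl hM
  · rintro ⟨n', -, hsat, hn⟩
    exact hsat.of_isInflation hn
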